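/- In the 1-planted REM with parameters (μ̂ log M, σ̂ √(log M / 2), M, 1), if γ = μ̂/σ̂ > 2, then P[l̂ = l] = 1 − M^{−(γ²/2 − 1) + o(1)} as M → ∞. -/

import Mathlib

open Real Filter MeasureTheory ProbabilityTheory

/-- Probability that the planted weight `E_l ~ N(μ̂ log M, σ̂² log M/2)` is at least
the maximum of `M` independent unbiased weights `N(0, σ̂² log M/2)` (1-planted REM). -/
noncomputable def premSuccess (μHat σHat : ℝ) (M : ℕ) : ℝ :=
  (((ProbabilityTheory.gaussianReal (μHat * Real.log M)
        (Real.toNNReal (σHat ^ 2 * Real.log M / 2))).prod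
      (MeasureTheory.Measure.pi fun _ : Fin M =>
        ProbabilityTheory.gaussianReal 0 (Real.toNNReal (σHat ^ 2 * Real.log M / 2))))
    {p : ℝ × (Fin M → ℝ) | ∀ i : Fin M, p.2 i ≤ p.1}).toReal

/-- Lower bound for the Gaussian mass of an interval of one standard deviation length. -/
lemma prem_gauss_lower (m a R s : ℝ) (hs : 0 < s)
    (hR : ∀ x ∈ Set.Ioc a (a + s), |x - m| ≤ R) :
    (√(2 * π))⁻¹ * rexp (-(R / s) ^ 2 / 2) ≤
      (gaussianReal m (Real.toNNReal (s ^ 2))).real (Set.Ioc a (a + s)) := by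
  have hv : Real.toNNReal (s ^ 2) ≠ 0 := by
    simp only [ne_eq, Real.toNNReal_eq_zero, not_le]; positivity
  have hcoe : ((Real.toNNReal (s ^ 2) : NNReal) : ℝ) = s ^ 2 :=
    Real.coe_toNNReal _ (by positivity)
  rw [measureReal_def, gaussianReal_apply_eq_integral _ hv, ENNReal.toReal_ofReal
    (setIntegral_nonneg measurableSet_Ioc fun x _ => gaussianPDFReal_nonneg _ _ _)]
  have hle : ∀ x ∈ Set.Ioc a (a + s), (√(2 * π * s ^ 2))⁻¹ * rexp (-(R / s) ^ 2 / 2) ≤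
      gaussianPDFReal m (Real.toNNReal (s ^ 2)) x := by
    intro x hx
    rw [gaussianPDFReal, hcoe]
    refine mul_le_mul_of_nonneg_left (Real.exp_le_exp.2 ?_) (by positivity)
    have h2 : (x - m) ^ 2 ≤ R ^ 2 := by
      rw [← sq_abs (x - m)]
      exact pow_le_pow_left₀ (abs_nonneg _) (hR x hx) 2
    have e : -(R / s) ^ 2 / 2 = -R ^ 2 / (2 * s ^ 2) := by field_simp
    rw [e]
    exact div_le_div_of_nonneg_right (by linarith) (by positivity)
  have hi := setIntegral_mono_on (μ := volume) (s := Set.Ioc a (a + s))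
    (f := fun _ => (√(2 * π * s ^ 2))⁻¹ * rexp (-(R / s) ^ 2 / 2))
    (g := gaussianPDFReal m (Real.toNNReal (s ^ 2)))
    (integrableOn_const (by simp)) ((integrable_gaussianPDFReal _ _).integrableOn) measurableSet_Ioc hle
  refine le_trans (le_of_eq ?_) hi
  rw [setIntegral_const, Real.volume_real_Ioc_of_le (by linarith), smul_eq_mul,
    Real.sqrt_mul (x := 2 * π) (by positivity) (s ^ 2), Real.sqrt_sq hs.le]
  field_simp
  ring

lemma prem_bern (q : ℝ) (h0 : 0 ≤ q) (h1 : q ≤ 1) (M : ℕ) (hM : M * q ≤ 1) :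
    M * q / 2 ≤ 1 - (1 - q) ^ M := by
  have hb := one_add_mul_le_pow (a := q) (by linarith) M
  have hp : (1 - q) ^ M * (1 + q) ^ M ≤ 1 := by
    rw [← mul_pow]
    exact pow_le_one₀ (by nlinarith) (by nlinarith)
  have hn : 0 ≤ (1 - q) ^ M := pow_nonneg (by linarith) _
  have hx : 0 ≤ (M : ℝ) * q := by positivity
  have h3 : (1 - q) ^ M * (1 + M * q) ≤ 1 := le_trans (by gcongr) hp
  set x := (M : ℝ) * q
  set A := (1 - q) ^ M
  by_contra! h
  have : (1 - x / 2) * (1 + x) < 1 := by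
    refine lt_of_lt_of_le ?_ h3
    exact mul_lt_mul_of_pos_right (by linarith) (by linarith)
  nlinarith

/-- The failure event. -/
lemma prem_compl (μHat σHat : ℝ) (M : ℕ) :
    1 - premSuccess μHat σHat M =
      ((gaussianReal (μHat * Real.log M) (Real.toNNReal (σHat ^ 2 * Real.log M / 2))).prod
      (Measure.pi fun _ : Fin M =>
        gaussianReal 0 (Real.toNNReal (σHat ^ 2 * Real.log M / 2)))).real
      {p : ℝ × (Fin M → ℝ) | ∃ i : Fin M, p.1 < p.2 i} := by
  have hm : MeasurableSet {p : ℝ × (Fin M → ℝ) | ∀ i : Fin M, p.2 i ≤ p.1} := by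
    rw [Set.ofPred_forall]
    refine MeasurableSet.iInter fun i => measurableSet_le (by fun_prop) (by fun_prop)
  have e : {p : ℝ × (Fin M → ℝ) | ∃ i : Fin M, p.1 < p.2 i} =
      {p : ℝ × (Fin M → ℝ) | ∀ i : Fin M, p.2 i ≤ p.1}ᶜ := by
    ext p; simp
  rw [e, probReal_compl_eq_one_sub hm]
  rfl

lemma prem_chernoff (m t : ℝ) (v : NNReal) (M : ℕ) (i : Fin M) (ht : 0 ≤ t) :
    ((gaussianReal m v).prod (Measure.pi fun _ : Fin M => gaussianReal 0 v)).real
      {p : ℝ × (Fin M → ℝ) | p.1 < p.2 i} ≤ rexp (v * t ^ 2 - m * t) := by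
  have hmp := measurePreserving_eval (fun _ : Fin M => gaussianReal 0 v) i
  have hi2 : Integrable (fun y : Fin M → ℝ => rexp (t * y i))
      (Measure.pi fun _ : Fin M => gaussianReal 0 v) :=
    hmp.integrable_comp_of_integrable (g := fun y => rexp (t * y))
      (integrable_exp_mul_gaussianReal t)
  have hi1 : Integrable (fun x : ℝ => rexp (-t * x)) (gaussianReal m v) :=
    integrable_exp_mul_gaussianReal (-t)
  have hint := hi1.mul_prod hi2
  have hms : MeasurableSet {p : ℝ × (Fin M → ℝ) | p.1 < p.2 i} :=
    measurableSet_lt (by fun_prop) (by fun_prop)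
  have I1 : ∫ x, rexp (-t * x) ∂(gaussianReal m v) = rexp (m * (-t) + v * (-t) ^ 2 / 2) := by
    have := congrFun (mgf_id_gaussianReal (μ := m) (v := v)) (-t)
    simpa [mgf] using this
  have I2 : ∫ y : Fin M → ℝ, rexp (t * y i) ∂(Measure.pi fun _ : Fin M => gaussianReal 0 v)
      = rexp (v * t ^ 2 / 2) := by
    have h := congrFun (mgf_id_gaussianReal (μ := 0) (v := v)) t
    have h2 : ∫ y, rexp (t * y) ∂(gaussianReal 0 v) = rexp (v * t ^ 2 / 2) := by
      simpa [mgf] using h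
    rw [← h2]
    have h3 := integral_map (μ := Measure.pi fun _ : Fin M => gaussianReal 0 v)
      (f := fun y : ℝ => rexp (t * y)) hmp.measurable.aemeasurable
      (by fun_prop)
    rw [hmp.map_eq] at h3
    exact h3.symm
  have hI := integral_prod_mul (μ := gaussianReal m v)
    (ν := Measure.pi fun _ : Fin M => gaussianReal 0 v)
    (fun x : ℝ => rexp (-t * x)) (fun y : Fin M → ℝ => rexp (t * y i))
  rw [I1, I2, ← Real.exp_add] at hI
  have e : m * (-t) + v * (-t) ^ 2 / 2 + v * t ^ 2 / 2 = v * t ^ 2 - m * t := by ring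
  rw [e] at hI
  rw [← hI, ← integral_indicator_one hms]
  refine integral_mono ((integrable_const (1 : ℝ)).indicator hms) hint ?_
  intro p
  by_cases hp : p ∈ {p : ℝ × (Fin M → ℝ) | p.1 < p.2 i}
  · simp only [Set.indicator_of_mem hp, Pi.one_apply]
    rw [← Real.exp_add]
    apply Real.one_le_exp
    have : p.1 < p.2 i := hp
    nlinarith
  · simp only [Set.indicator_of_notMem hp]
    positivity

lemma prem_upper (μHat σHat : ℝ) (hμ : 0 < μHat) (hσ : 0 < σHat) (M : ℕ) (hM : 2 ≤ M) :
    1 - premSuccess μHat σHat M ≤ M * rexp (-((μHat / σHat) ^ 2 / 2 * Real.log M)) := by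
  have hL : 0 < Real.log M := Real.log_pos (by exact_mod_cast hM)
  rw [prem_compl, Set.ofPred_exists]
  refine (measureReal_iUnion_fintype_le _).trans ?_
  refine (Finset.sum_le_sum fun i _ =>
    prem_chernoff _ (μHat / σHat ^ 2) _ M i (by positivity)).trans ?_
  rw [Finset.sum_const, Finset.card_univ, Fintype.card_fin, nsmul_eq_mul,
    Real.coe_toNNReal _ (by positivity)]
  apply le_of_eq
  congr 2
  field_simp
  ring

lemma prem_lower (μHat σHat : ℝ) (hμ : 0 < μHat) (hσ : 0 < σHat) (M : ℕ) (hM : 2 ≤ M)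
    (q : ℝ) (hq : q = (√(2 * π))⁻¹ *
      rexp (-(μHat / σHat * √(Real.log M / 2) + 1) ^ 2 / 2)) (hMq : M * q ≤ 1) :
    M * q ^ 2 / 2 ≤ 1 - premSuccess μHat σHat M := by
  have hL : 0 < Real.log M := Real.log_pos (by exact_mod_cast hM)
  set L := Real.log M with hLdef
  set s := σHat * √(L / 2) with hs
  have hsq : √(L / 2) ^ 2 = L / 2 := Real.sq_sqrt (by positivity)
  have hs2 : σHat ^ 2 * L / 2 = s ^ 2 := by rw [hs, mul_pow, hsq]; ring
  have hspos : 0 < s := by positivity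
  set a := μHat * L / 2 with ha
  have hapos : 0 < a := by positivity
  have hq0 : 0 ≤ q := by rw [hq]; positivity
  have hRs : (a + s) / s = μHat / σHat * √(L / 2) + 1 := by
    have : a = μHat * √(L / 2) ^ 2 := by rw [hsq, ha]; ring
    have h0 : 0 < √(L / 2) := by positivity
    rw [this, hs]
    field_simp
  have hX : q ≤ (gaussianReal 0 (Real.toNNReal (s ^ 2))).real (Set.Ioi a) := by
    have := prem_gauss_lower 0 a (a + s) s hspos (by
      intro x hx; rw [abs_le]; constructor <;> linarith [hx.1, hx.2])
    rw [hRs, ← hq] at this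
    exact this.trans (measureReal_mono Set.Ioc_subset_Ioi_self)
  have hE : q ≤ (gaussianReal (μHat * L) (Real.toNNReal (s ^ 2))).real (Set.Iic a) := by
    have := prem_gauss_lower (μHat * L) (a - s) (a + s) s hspos (by
      intro x hx; rw [abs_le]; constructor <;> linarith [hx.1, hx.2])
    rw [hRs, ← hq] at this
    refine this.trans (measureReal_mono ?_)
    intro x hx
    have := hx.2
    simp only [Set.mem_Iic]; linarith
  have hq1 : q ≤ 1 := hX.trans measureReal_le_one
  rw [prem_compl, ← hLdef, hs2]
  set G := gaussianReal 0 (Real.toNNReal (s ^ 2))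
  have hsub : (Set.Iic a) ×ˢ (Set.univ.pi fun _ : Fin M => Set.Iic a)ᶜ ⊆
      {p : ℝ × (Fin M → ℝ) | ∃ i : Fin M, p.1 < p.2 i} := by
    rintro ⟨x, y⟩ ⟨hx, hy⟩
    simp only [Set.mem_compl_iff, Set.mem_univ_pi, Set.mem_Iic, not_forall, not_le] at hx hy
    obtain ⟨i, hi⟩ := hy
    exact ⟨i, lt_of_le_of_lt hx hi⟩
  refine le_trans ?_ (measureReal_mono hsub)
  rw [measureReal_prod_prod, probReal_compl_eq_one_sub
    (MeasurableSet.univ_pi fun _ => measurableSet_Iic)]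
  have hpi : (Measure.pi fun _ : Fin M => G).real (Set.univ.pi fun _ : Fin M => Set.Iic a)
      = (G.real (Set.Iic a)) ^ M := by
    rw [measureReal_def, Measure.pi_pi]
    simp [measureReal_def]
  have hF : G.real (Set.Iic a) ≤ 1 - q := by
    have := probReal_compl_eq_one_sub (μ := G) (measurableSet_Iic (a := a))
    rw [Set.compl_Iic] at this
    linarith
  have hpow : (G.real (Set.Iic a)) ^ M ≤ (1 - q) ^ M :=
    pow_le_pow_left₀ measureReal_nonneg hF M
  have hb := prem_bern q hq0 hq1 M hMq
  rw [hpi]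
  calc M * q ^ 2 / 2 = q * (M * q / 2) := by ring
    _ ≤ _ := by
      apply mul_le_mul hE (by linarith) (by positivity) measureReal_nonneg

/-- in the 1-planted REM with parameters
`(μ̂ log M, σ̂ √(log M/2), M, 1)`, if `γ = μ̂/σ̂ > 2`, then
`P[l̂ = l] = 1 − M^{−(γ²/2 − 1) + o(1)}`, i.e. `log(1 − P)/log M → −(γ²/2 − 1)`. -/
theorem stmt8 (μHat σHat : ℝ) (hμ : 0 < μHat) (hσ : 0 < σHat)
    (hγ : 2 < μHat / σHat) :
    Tendsto (fun M : ℕ => Real.log (1 - premSuccess μHat σHat M) / Real.log M)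
      atTop (nhds (-((μHat / σHat) ^ 2 / 2 - 1))) := by
  set γ := μHat / σHat with hγdef
  have hlog : Tendsto (fun M : ℕ => Real.log M) atTop atTop :=
    Real.tendsto_log_atTop.comp tendsto_natCast_atTop_atTop
  have hsqrt : Tendsto (fun M : ℕ => √(Real.log M / 2)) atTop atTop :=
    Real.tendsto_sqrt_atTop.comp (hlog.atTop_div_const (by norm_num))
  have hinv : Tendsto (fun M : ℕ => (√(Real.log M / 2))⁻¹) atTop (nhds 0) :=
    tendsto_inv_atTop_zero.comp hsqrt
  have hinv2 : Tendsto (fun M : ℕ => (Real.log M)⁻¹) atTop (nhds 0) :=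
    tendsto_inv_atTop_zero.comp hlog
  set C := 2 * Real.log (√(2 * π)) + Real.log 2 with hC
  have hlow : Tendsto (fun M : ℕ => 1 - (γ + (√(Real.log M / 2))⁻¹) ^ 2 / 2
      - C * (Real.log M)⁻¹) atTop (nhds (-(γ ^ 2 / 2 - 1))) := by
    have := ((tendsto_const_nhds (x := (1 : ℝ))).sub
      ((((tendsto_const_nhds (x := γ)).add hinv).pow 2).div_const 2)).sub (hinv2.const_mul C)
    convert this using 2
    ring
  have key : ∀ M : ℕ, 2 ≤ M →
      0 < 1 - premSuccess μHat σHat M ∧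
      1 - (γ + (√(Real.log M / 2))⁻¹) ^ 2 / 2 - C * (Real.log M)⁻¹ ≤
        Real.log (1 - premSuccess μHat σHat M) / Real.log M := by
    intro M hM
    have hL : 0 < Real.log M := Real.log_pos (by exact_mod_cast hM)
    have hM0 : (0 : ℝ) < M := by positivity
    have hr : 0 < √(Real.log M / 2) := by positivity
    have hsq : √(Real.log M / 2) ^ 2 = Real.log M / 2 := Real.sq_sqrt (by positivity)
    have hpi : 1 ≤ √(2 * π) := by
      rw [Real.one_le_sqrt]; linarith [Real.pi_gt_three]
    set r := √(Real.log M / 2) with hrdef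
    set q := (√(2 * π))⁻¹ * rexp (-(γ * r + 1) ^ 2 / 2) with hq
    have hq0 : 0 < q := by positivity
    have hMq : M * q ≤ 1 := by
      have h1 : q ≤ rexp (-Real.log M) := by
        calc q ≤ 1 * rexp (-(γ * r + 1) ^ 2 / 2) := by
              rw [hq]; gcongr; exact inv_le_one_of_one_le₀ hpi
          _ ≤ rexp (-Real.log M) := by
              rw [one_mul]
              apply Real.exp_le_exp.2
              have : 2 * r ≤ γ * r + 1 := by nlinarith
              have := pow_le_pow_left₀ (by positivity) this 2
              nlinarith
      rw [Real.exp_neg, Real.exp_log hM0] at h1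
      calc M * q ≤ M * (M : ℝ)⁻¹ := by gcongr
        _ = 1 := by field_simp
    have hl := prem_lower μHat σHat hμ hσ M hM q hq hMq
    have hpos : 0 < M * q ^ 2 / 2 := by positivity
    refine ⟨hpos.trans_le hl, ?_⟩
    rw [le_div_iff₀ hL]
    refine le_trans (le_of_eq ?_) (Real.log_le_log hpos hl)
    rw [Real.log_div (by positivity) (by norm_num), Real.log_mul (by positivity) (by positivity),
      Real.log_pow, hq, Real.log_mul (by positivity) (by positivity), Real.log_exp, Real.log_inv,
      hC]
    have hL2 : Real.log M = 2 * r ^ 2 := by linarith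
    rw [hL2]
    field_simp
    push_cast
    ring
  refine tendsto_of_tendsto_of_tendsto_of_le_of_le' hlow tendsto_const_nhds ?_ ?_
  · filter_upwards [eventually_ge_atTop 2] with M hM using (key M hM).2
  · filter_upwards [eventually_ge_atTop 2] with M hM
    have hL : 0 < Real.log M := Real.log_pos (by exact_mod_cast hM)
    have hM0 : (0 : ℝ) < M := by positivity
    rw [div_le_iff₀ hL]
    refine (Real.log_le_log (key M hM).1 (prem_upper μHat σHat hμ hσ M hM)).trans (le_of_eq ?_)
    rw [Real.log_mul (by positivity) (by positivity), Real.log_exp]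
    ring
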